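/- Let T and (T_i)_{i∈I} be triangulated categories with all small coproducts, suppose each T_i is compactly generated by a set G_i of compact objects, and suppose for each i there is an exact (triangulated) coproduct-preserving functor F_i : T → T_i admitting an exact left adjoint L_i. Assume the detection property: an object X of T is isomorphic to 0 if and only if F_iX ≅ 0 for all i ∈ I. Then each object L_i(c) with c ∈ G_i is compact in T, and T is compactly generated by the set {L_i(c) : i ∈ I, c ∈ G_i}. -/

import Mathlib

open CategoryTheory CategoryTheory.Limits CategoryTheory.Pretriangulated

universe v u u₂

section Defs

variable (C : Type u) [Category.{v} C] [Preadditive C] [HasCoproducts.{v} C]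

/-- The canonical map `⨁ᵢ Hom(X, Yᵢ) → Hom(X, ∐ Y)`. -/
noncomputable def coproductComparison (X : C) {ι : Type v} (Y : ι → C) :
    DirectSum ι (fun i => X ⟶ Y i) →+ (X ⟶ ∐ Y) := by
  classical
  exact DirectSum.toAddMonoid fun i =>
    AddMonoidHom.mk' (fun g => g ≫ Sigma.ι Y i)
      (fun a b => Preadditive.add_comp _ _ _ a b (Sigma.ι Y i))

variable {C} in
/-- An object `X` is compact if `Hom(X, -)` commutes with small coproducts, i.e. the
canonical map `⨁ᵢ Hom(X, Yᵢ) → Hom(X, ∐ Y)` is bijective for every small family `Y`. -/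
def IsCompactObject (X : C) : Prop :=
  ∀ ⦃ι : Type v⦄ (Y : ι → C), Function.Bijective (coproductComparison C X Y)

variable [HasZeroObject C] [HasShift C ℤ] [∀ n : ℤ, (shiftFunctor C n).Additive]
  [Pretriangulated C]

/-- A localising subcategory: a full triangulated subcategory closed under direct
summands and small coproducts. -/
def IsLocalisingSubcategory (L : Set C) : Prop :=
  (∀ ⦃X Y : C⦄, (X ≅ Y) → X ∈ L → Y ∈ L) ∧
  (∀ X : C, IsZero X → X ∈ L) ∧
  (∀ ⦃X : C⦄ (n : ℤ), X ∈ L → (X⟦n⟧ : C) ∈ L) ∧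
  (∀ T : Triangle C, T ∈ (distTriang C) → T.obj₁ ∈ L → T.obj₂ ∈ L → T.obj₃ ∈ L) ∧
  (∀ ⦃X Y : C⦄ (i : X ⟶ Y) (r : Y ⟶ X), i ≫ r = 𝟙 X → Y ∈ L → X ∈ L) ∧
  (∀ ⦃ι : Type v⦄ (f : ι → C), (∀ j, f j ∈ L) → (∐ f) ∈ L)

/-- A triangulated category with coproducts is compactly generated by a set `S` of compact
objects if every member of `S` is compact and the only localising subcategory containing
`S` is the whole category. -/
def IsCompactlyGeneratedBy (S : Set C) : Prop :=
  (∀ X ∈ S, IsCompactObject X) ∧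
  (∀ L : Set C, IsLocalisingSubcategory C L → S ⊆ L → ∀ X : C, X ∈ L)

end Defs

section Compact

variable {C : Type u} [Category.{v} C] [Preadditive C] [HasCoproducts.{v} C]

lemma coproductComparison_of {X : C} {ι : Type v} [hι : DecidableEq ι] (Y : ι → C) (i : ι)
    (g : X ⟶ Y i) :
    coproductComparison C X Y (DirectSum.of (fun i => X ⟶ Y i) i g) = g ≫ Sigma.ι Y i := by
  obtain rfl : hι = Classical.decEq ι := Subsingleton.elim _ _
  classical
  exact DirectSum.toAddMonoid_of (fun i => AddMonoidHom.mk' (fun g => g ≫ Sigma.ι Y i)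
    (fun a b => Preadditive.add_comp X _ _ a b (Sigma.ι Y i))) i g

lemma coproductComparison_comp_π {X : C} {ι : Type v} [DecidableEq ι] (Y : ι → C)
    (i : ι) (x : DirectSum ι (fun i => X ⟶ Y i)) :
    coproductComparison C X Y x ≫ Sigma.π Y i = x i := by
  induction x using DirectSum.induction_on with
  | zero => simp
  | add x y hx hy => simp [Preadditive.add_comp, hx, hy]
  | of j g =>
    rw [coproductComparison_of, Category.assoc]
    by_cases h : j = i
    · subst h
      simp
    · rw [Sigma.ι_π_of_ne _ h, DirectSum.of_eq_of_ne _ _ _ (Ne.symm h), comp_zero]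

lemma isCompactObject_iff (X : C) :
    IsCompactObject X ↔ ∀ ⦃ι : Type v⦄ (Y : ι → C) (f : X ⟶ ∐ Y),
      ∃ (s : Finset ι) (g : ∀ i, X ⟶ Y i), f = ∑ i ∈ s, g i ≫ Sigma.ι Y i := by
  classical
  refine ⟨fun h ι Y f => ?_, fun h ι Y => ⟨?_, fun f => ?_⟩⟩
  · obtain ⟨x, rfl⟩ := (h Y).2 f
    refine ⟨DFinsupp.support x, fun i => x i, ?_⟩
    conv_lhs => rw [← DirectSum.sum_support_of x]
    rw [map_sum]
    exact Finset.sum_congr rfl fun i _ => coproductComparison_of Y i _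
  · rw [injective_iff_map_eq_zero]
    intro x hx
    ext i
    rw [← coproductComparison_comp_π, hx, zero_comp]
    rfl
  · obtain ⟨s, g, rfl⟩ := h Y f
    refine ⟨∑ i ∈ s, DirectSum.of (fun i => X ⟶ Y i) i (g i), ?_⟩
    rw [map_sum]
    exact Finset.sum_congr rfl fun i _ => coproductComparison_of Y i _

variable {D : Type u₂} [Category.{v} D] [Preadditive D] [HasCoproducts.{v} D]

/-- A map from a compact object to the image of a coproduct under a coproduct-preserving
functor is a finite sum of maps through the images of the summands. -/
lemma IsCompactObject.exists_eq_sum_map {B : Type u} [Category.{v} B]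
    [HasCoproducts.{v} B] {c : D} (hc : IsCompactObject c) (H : B ⥤ D) {ι : Type v}
    [PreservesColimitsOfShape (Discrete ι) H] (Y : ι → B) (f : c ⟶ H.obj (∐ Y)) :
    ∃ (s : Finset ι) (g : ∀ i, c ⟶ H.obj (Y i)), f = ∑ i ∈ s, g i ≫ H.map (Sigma.ι Y i) := by
  obtain ⟨s, g, hg⟩ := (isCompactObject_iff c).1 hc _ (f ≫ (PreservesCoproduct.iso H Y).hom)
  refine ⟨s, g, ?_⟩
  rw [← cancel_mono (PreservesCoproduct.iso H Y).hom, hg, Preadditive.sum_comp]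
  refine Finset.sum_congr rfl fun i _ => ?_
  rw [Category.assoc]
  congr 1
  rw [← Iso.comp_inv_eq]
  simp

/-- Maps from a compact object to the image of a coproduct are determined by their
components. -/
lemma IsCompactObject.eq_zero_of_comp_map_π {c : D} (hc : IsCompactObject c) (H : C ⥤ D)
    [H.Additive] {ι : Type v} [DecidableEq ι]
    [PreservesColimitsOfShape (Discrete ι) H] (Y : ι → C)
    (f : c ⟶ H.obj (∐ Y)) (hf : ∀ i, f ≫ H.map (Sigma.π Y i) = 0) : f = 0 := by
  obtain ⟨s, g, rfl⟩ := hc.exists_eq_sum_map H Y f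
  refine Finset.sum_eq_zero fun i hi => ?_
  have h := hf i
  rw [Preadditive.sum_comp, Finset.sum_eq_single i, Category.assoc, ← H.map_comp,
    Sigma.ι_π_eq_id, H.map_id, Category.comp_id] at h
  · rw [h, zero_comp]
  · intro j _ hj
    rw [Category.assoc, ← H.map_comp, Sigma.ι_π_of_ne _ hj, H.map_zero, comp_zero]
  · exact fun h => (h hi).elim

/-- A left adjoint of a coproduct-preserving functor preserves compact objects. -/
lemma IsCompactObject.of_adjunction {L : D ⥤ C} {F : C ⥤ D} (adj : L ⊣ F) [L.Additive]
    [∀ ι : Type v, PreservesColimitsOfShape (Discrete ι) F] {c : D} (hc : IsCompactObject c) :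
    IsCompactObject (L.obj c) := by
  rw [isCompactObject_iff]
  intro ι Y f
  obtain ⟨s, g, hg⟩ := hc.exists_eq_sum_map F Y (adj.homEquiv _ _ f)
  refine ⟨s, fun i => (adj.homEquiv _ _).symm (g i), ?_⟩
  rw [← (adj.homEquiv _ _).symm_apply_apply f, hg, adj.homEquiv_counit, L.map_sum,
    Preadditive.sum_comp]
  refine Finset.sum_congr rfl fun i _ => ?_
  simp [adj.homEquiv_counit]

lemma IsCompactObject.shift [HasShift C ℤ] [∀ n : ℤ, (shiftFunctor C n).Additive] {c : C}
    (hc : IsCompactObject c) (n : ℤ) : IsCompactObject (c⟦n⟧) :=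
  hc.of_adjunction (L := shiftFunctor C n) (F := shiftFunctor C (-n))
    (shiftEquiv C n).toAdjunction

end Compact

section Localising

variable {C : Type u} [Category.{v} C] [Preadditive C] [HasCoproducts.{v} C]
  [HasZeroObject C] [HasShift C ℤ] [∀ n : ℤ, (shiftFunctor C n).Additive] [Pretriangulated C]

namespace IsLocalisingSubcategory

lemma mem_of_iso {L : Set C} (hL : IsLocalisingSubcategory C L)
    ⦃X Y : C⦄ (e : X ≅ Y) (hX : X ∈ L) : Y ∈ L :=
  hL.1 e hX

lemma mem_of_isZero {L : Set C} (hL : IsLocalisingSubcategory C L)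
    (X : C) (hX : IsZero X) : X ∈ L :=
  hL.2.1 X hX

lemma shift_mem {L : Set C} (hL : IsLocalisingSubcategory C L)
    ⦃X : C⦄ (n : ℤ) (hX : X ∈ L) : X⟦n⟧ ∈ L :=
  hL.2.2.1 n hX

lemma obj₃_mem {L : Set C} (hL : IsLocalisingSubcategory C L)
    (T : Triangle C) (hT : T ∈ distTriang C) (h₁ : T.obj₁ ∈ L)
    (h₂ : T.obj₂ ∈ L) : T.obj₃ ∈ L :=
  hL.2.2.2.1 T hT h₁ h₂

lemma mem_of_retract {L : Set C} (hL : IsLocalisingSubcategory C L)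
    ⦃X Y : C⦄ (i : X ⟶ Y) (r : Y ⟶ X) (h : i ≫ r = 𝟙 X) (hY : Y ∈ L) :
    X ∈ L :=
  hL.2.2.2.2.1 i r h hY

lemma sigma_mem {L : Set C} (hL : IsLocalisingSubcategory C L)
    ⦃ι : Type v⦄ (f : ι → C) (hf : ∀ j, f j ∈ L) : ∐ f ∈ L :=
  hL.2.2.2.2.2 f hf

end IsLocalisingSubcategory

/-- The preimage of a localising subcategory under an exact coproduct-preserving functor is
localising. -/
lemma IsLocalisingSubcategory.preimage {D : Type u₂} [Category.{v} D] [Preadditive D]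
    [HasCoproducts.{v} D] [HasZeroObject D] [HasShift D ℤ]
    [∀ n : ℤ, (shiftFunctor D n).Additive] [Pretriangulated D] {L : Set D}
    (hL : IsLocalisingSubcategory D L) (F : C ⥤ D) [F.CommShift ℤ] [F.IsTriangulated]
    [∀ ι : Type v, PreservesColimitsOfShape (Discrete ι) F] :
    IsLocalisingSubcategory C (F.obj ⁻¹' L) :=
  ⟨fun _ _ e hX => hL.mem_of_iso (F.mapIso e) hX,
    fun _ hX => hL.mem_of_isZero _ (F.map_isZero hX),
    fun X n hX => hL.mem_of_iso ((F.commShiftIso n).symm.app X) (hL.shift_mem n hX),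
    fun T hT h₁ h₂ => hL.obj₃_mem _ (F.map_distinguished T hT) h₁ h₂,
    fun X Y i r h hY => hL.mem_of_retract (F.map i) (F.map r)
      (by rw [← F.map_comp, h, F.map_id]) hY,
    fun ι f hf => hL.mem_of_iso (PreservesCoproduct.iso F f).symm (hL.sigma_mem _ hf)⟩

/-- The smallest localising subcategory containing a given set of objects. -/
def localisingClosure (S : Set C) : Set C :=
  {X | ∀ L : Set C, IsLocalisingSubcategory C L → S ⊆ L → X ∈ L}

lemma subset_localisingClosure (S : Set C) : S ⊆ localisingClosure S :=
  fun _ hX _ _ hS => hS hX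

lemma isLocalisingSubcategory_localisingClosure (S : Set C) :
    IsLocalisingSubcategory C (localisingClosure S) :=
  ⟨fun _ _ e hX L hL hS => hL.mem_of_iso e (hX L hL hS),
    fun X hX _ hL _ => hL.mem_of_isZero X hX,
    fun _ n hX L hL hS => hL.shift_mem n (hX L hL hS),
    fun T hT h₁ h₂ L hL hS => hL.obj₃_mem T hT (h₁ L hL hS) (h₂ L hL hS),
    fun _ _ i r h hY L hL hS => hL.mem_of_retract i r h (hY L hL hS),
    fun _ f hf L hL hS => hL.sigma_mem f fun j => hf j L hL hS⟩

lemma localisingClosure_subset {S L : Set C} (hL : IsLocalisingSubcategory C L) (h : S ⊆ L) :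
    localisingClosure S ⊆ L :=
  fun _ hX => hX L hL h

lemma localisingClosure_mono {S₁ S₂ : Set C} (h : S₁ ⊆ S₂) :
    localisingClosure S₁ ⊆ localisingClosure S₂ :=
  localisingClosure_subset (isLocalisingSubcategory_localisingClosure S₂)
    (h.trans (subset_localisingClosure S₂))

/-- Every object in the localising closure of a (possibly large) class of objects lies in the
localising closure of a small subset. -/
lemma exists_small_of_mem_localisingClosure {S : Set C} {X : C} (hX : X ∈ localisingClosure S) :
    ∃ S' ⊆ S, Small.{v} S' ∧ X ∈ localisingClosure S' := by
  have hloc := isLocalisingSubcategory_localisingClosure (C := C)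
  refine hX {X | ∃ S' ⊆ S, Small.{v} S' ∧ X ∈ localisingClosure S'}
    ⟨?_, ?_, ?_, ?_, ?_, ?_⟩ ?_
  · rintro X Y e ⟨S', h, hs, hX⟩
    exact ⟨S', h, hs, (hloc S').mem_of_iso e hX⟩
  · intro X hX
    exact ⟨∅, Set.empty_subset _, inferInstance, (hloc ∅).mem_of_isZero X hX⟩
  · rintro X n ⟨S', h, hs, hX⟩
    exact ⟨S', h, hs, (hloc S').shift_mem n hX⟩
  · rintro T hT ⟨S₁, h₁, hs₁, hX₁⟩ ⟨S₂, h₂, hs₂, hX₂⟩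
    exact ⟨S₁ ∪ S₂, Set.union_subset h₁ h₂, small_union _ _, (hloc _).obj₃_mem T hT
      (localisingClosure_mono Set.subset_union_left hX₁)
      (localisingClosure_mono Set.subset_union_right hX₂)⟩
  · rintro X Y i r h ⟨S', h', hs, hY⟩
    exact ⟨S', h', hs, (hloc S').mem_of_retract i r h hY⟩
  · intro ι f hf
    choose S' h hs hX using hf
    exact ⟨⋃ j, S' j, Set.iUnion_subset h, small_iUnion _, (hloc _).sigma_mem f fun j =>
      localisingClosure_mono (Set.subset_iUnion S' j) (hX j)⟩
  · intro X hX
    exact ⟨{X}, Set.singleton_subset_iff.2 hX, inferInstance, subset_localisingClosure _ rfl⟩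

lemma isLocalisingSubcategory_leftOrthogonal (P : ObjectProperty C) [P.IsStableUnderShift ℤ] :
    IsLocalisingSubcategory C {X | P.leftOrthogonal X} := by
  refine ⟨fun X Y e hX => P.leftOrthogonal.prop_of_iso e hX,
    fun X hX => P.leftOrthogonal.prop_of_isZero hX,
    fun X n hX => P.leftOrthogonal.le_shift n X hX,
    fun T hT h₁ h₂ => P.leftOrthogonal.ext_of_isTriangulatedClosed₃ T hT h₁ h₂,
    fun X Y i r h hY Z f hZ => ?_, fun ι f hf Z g hZ => ?_⟩
  · rw [← Category.id_comp f, ← h, Category.assoc, hY (r ≫ f) hZ, comp_zero]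
  · ext j
    rw [hf j (Sigma.ι f j ≫ g) hZ, comp_zero]

/-- An object of the localising closure of `S` that is right orthogonal to all shifts of objects
in `S` is zero. -/
lemma isZero_of_mem_localisingClosure {S : Set C} {Y : C} (hY : Y ∈ localisingClosure S)
    (h : ∀ x ∈ S, ∀ (n : ℤ) (f : x⟦n⟧ ⟶ Y), f = 0) : IsZero Y := by
  let P : ObjectProperty C := (ObjectProperty.shiftClosure (fun x => x ∈ S) ℤ).rightOrthogonal
  have hS : S ⊆ {X | P.leftOrthogonal X} := fun x hx Z f hZ =>
    hZ f (ObjectProperty.le_shiftClosure _ _ hx)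
  have hP : P Y := by
    intro X f hX
    rw [ObjectProperty.prop_shiftClosure_iff] at hX
    obtain ⟨x, n, e, hx⟩ := hX
    rw [← cancel_epi e.inv, h x hx n (e.inv ≫ f), comp_zero]
  rw [IsZero.iff_id_eq_zero]
  exact localisingClosure_subset (isLocalisingSubcategory_leftOrthogonal P) hS hY (𝟙 Y) hP

/-- Sequential homotopy colimits of objects over `X`. -/
lemma IsLocalisingSubcategory.exists_homotopyColimit {L : Set C}
    (hL : IsLocalisingSubcategory C L) {X : C} (Z : ℕ → C) (hZ : ∀ n, Z n ∈ L)
    (t : ∀ n, Z n ⟶ Z (n + 1)) (p : ∀ n, Z n ⟶ X) (hp : ∀ n, t n ≫ p (n + 1) = p n) :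
    ∃ (H : C) (_ : H ∈ L) (j : ∀ n, Z n ⟶ H) (q : H ⟶ X),
      (∀ n, t n ≫ j (n + 1) = j n) ∧ (∀ n, j n ≫ q = p n) ∧
      ∀ ⦃c : C⦄, IsCompactObject c → ∀ f : c ⟶ H, ∃ (n : ℕ) (g : c ⟶ Z n), f = g ≫ j n := by
  let Y : ULift.{v} ℕ → C := fun i => Z i.down
  let sh : ∐ Y ⟶ ∐ Y := Sigma.desc fun i => t i.down ≫ Sigma.ι Y ⟨i.down + 1⟩
  have ι_sh (n : ℕ) : Sigma.ι Y ⟨n⟩ ≫ sh = t n ≫ Sigma.ι Y ⟨n + 1⟩ := by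
    simp [sh]
  have sh_π_zero : sh ≫ Sigma.π Y ⟨0⟩ = 0 := by
    ext ⟨n⟩
    rw [← Category.assoc, ι_sh, Category.assoc, Sigma.ι_π_of_ne _ (by simp), comp_zero, comp_zero]
  have sh_π_succ (n : ℕ) : sh ≫ Sigma.π Y ⟨n + 1⟩ = Sigma.π Y ⟨n⟩ ≫ t n := by
    ext ⟨m⟩
    rw [← Category.assoc, ι_sh, Category.assoc, ← Category.assoc (Sigma.ι Y _)]
    by_cases h : m = n
    · subst h
      rw [Sigma.ι_π_eq_id, Sigma.ι_π_eq_id, Category.comp_id, Category.id_comp]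
    · rw [Sigma.ι_π_of_ne _ (by simpa using h), Sigma.ι_π_of_ne _ (by simpa using h),
        comp_zero, zero_comp]
  obtain ⟨H, π, δ, hT⟩ := distinguished_cocone_triangle (𝟙 (∐ Y) - sh)
  have hπ : sh ≫ π = π := by
    have : (𝟙 (∐ Y) - sh) ≫ π = 0 := comp_distTriang_mor_zero₁₂ _ hT
    rw [Preadditive.sub_comp, Category.id_comp, sub_eq_zero] at this
    exact this.symm
  let d : ∐ Y ⟶ X := Sigma.desc fun i => p i.down
  have hd : (𝟙 (∐ Y) - sh) ≫ d = 0 := by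
    ext ⟨n⟩
    simp [d, Preadditive.sub_comp, Preadditive.comp_sub, reassoc_of% ι_sh, hp]
  obtain ⟨q, hq⟩ : ∃ q : H ⟶ X, d = π ≫ q :=
    Triangle.yoneda_exact₂ _ hT _ hd
  have hj (n : ℕ) : t n ≫ Sigma.ι Y ⟨n + 1⟩ ≫ π = Sigma.ι Y ⟨n⟩ ≫ π := by
    rw [← Category.assoc, ← ι_sh, Category.assoc, hπ]
  refine ⟨H, hL.obj₃_mem _ hT (hL.sigma_mem Y fun i => hZ _) (hL.sigma_mem Y fun i => hZ _),
    fun n => Sigma.ι Y ⟨n⟩ ≫ π, q, hj, fun n => ?_, fun c hc f => ?_⟩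
  · rw [Category.assoc, ← hq]
    simp [d]
  have hδ : f ≫ δ = 0 := by
    have hsh : (f ≫ δ) ≫ sh⟦(1 : ℤ)⟧' = f ≫ δ := by
      have : δ ≫ (𝟙 (∐ Y) - sh)⟦(1 : ℤ)⟧' = 0 := comp_distTriang_mor_zero₃₁ _ hT
      rw [Functor.map_sub, CategoryTheory.Functor.map_id, Preadditive.comp_sub, Category.comp_id,
        sub_eq_zero] at this
      rw [Category.assoc, ← this]
    refine hc.eq_zero_of_comp_map_π (shiftFunctor C (1 : ℤ)) Y _ ?_
    rintro ⟨n⟩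
    induction n with
    | zero => rw [← hsh, Category.assoc, ← Functor.map_comp, sh_π_zero, Functor.map_zero, comp_zero]
    | succ n ih =>
      rw [← hsh, Category.assoc, ← Functor.map_comp, sh_π_succ, Functor.map_comp,
        ← Category.assoc, ih, zero_comp]
  obtain ⟨u, hu⟩ : ∃ u : c ⟶ ∐ Y, f = u ≫ π := Triangle.coyoneda_exact₃ _ hT f hδ
  obtain ⟨s, g, rfl⟩ := (isCompactObject_iff c).1 hc Y u
  have factor (n N : ℕ) (h : n ≤ N) :
      ∃ τ : Z n ⟶ Z N, Sigma.ι Y ⟨n⟩ ≫ π = τ ≫ Sigma.ι Y ⟨N⟩ ≫ π := by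
    induction h with
    | refl => exact ⟨𝟙 _, (Category.id_comp _).symm⟩
    | step h ih =>
      obtain ⟨τ, hτ⟩ := ih
      exact ⟨τ ≫ t _, by rw [hτ, Category.assoc, hj]⟩
  choose! τ hτ using factor
  refine ⟨s.sup ULift.down, ∑ i ∈ s, g i ≫ τ i.down (s.sup ULift.down), ?_⟩
  rw [hu, Preadditive.sum_comp, Preadditive.sum_comp]
  refine Finset.sum_congr rfl fun i hi => ?_
  rw [Category.assoc, Category.assoc, ← hτ _ _ (Finset.le_sup hi)]

/-- Attaching cells to an object over `X` in order to kill the maps from the objects `s k` that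
become zero in `X`. -/
lemma IsLocalisingSubcategory.exists_kill {L : Set C} (hL : IsLocalisingSubcategory C L)
    {κ : Type v} (s : κ → C) (hs : ∀ k, s k ∈ L) {X : C} (W : Over X) (hW : W.left ∈ L) :
    ∃ (W' : Over X) (t : W ⟶ W'), W'.left ∈ L ∧
      ∀ k (f : s k ⟶ W.left), f ≫ W.hom = 0 → f ≫ t.left = 0 := by
  let J := Σ k, {f : s k ⟶ W.left // f ≫ W.hom = 0}
  let e : (∐ fun j : J => s j.1) ⟶ W.left := Sigma.desc fun j => j.2.1
  obtain ⟨Z, t, δ, hT⟩ := distinguished_cocone_triangle e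
  have he : e ≫ W.hom = 0 := by
    ext j
    simp [e, j.2.2]
  obtain ⟨q, hq⟩ : ∃ q : Z ⟶ X, W.hom = t ≫ q := Triangle.yoneda_exact₂ _ hT _ he
  refine ⟨Over.mk q, Over.homMk t hq.symm,
    hL.obj₃_mem _ hT (hL.sigma_mem _ fun j => hs j.1) hW, fun k f hf => ?_⟩
  have h : f = Sigma.ι (fun j : J => s j.1) ⟨k, f, hf⟩ ≫ e := by simp [e]
  have h₀ : e ≫ t = 0 := comp_distTriang_mor_zero₁₂ _ hT
  change f ≫ t = 0
  rw [h, Category.assoc, h₀, comp_zero]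

/-- Approximation of an object by the localising subcategory generated by a small family of
compact objects. -/
lemma IsLocalisingSubcategory.exists_approximation {L : Set C}
    (hL : IsLocalisingSubcategory C L) {κ : Type v} (s : κ → C) (hs : ∀ k, s k ∈ L)
    (hc : ∀ k, IsCompactObject (s k)) (X : C) :
    ∃ (X' : C) (q : X' ⟶ X), X' ∈ L ∧
      ∀ k, Function.Bijective (fun f : s k ⟶ X' => f ≫ q) := by
  choose next t hnext ht using fun W : {W : Over X // W.left ∈ L} =>
    hL.exists_kill s hs W.1 W.2
  let J := Σ k, (s k ⟶ X)
  let W₀ : {W : Over X // W.left ∈ L} :=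
    ⟨Over.mk (Sigma.desc fun j : J => j.2), hL.sigma_mem (fun j : J => s j.1) fun j => hs j.1⟩
  let W : ℕ → {W : Over X // W.left ∈ L} := fun n =>
    Nat.rec W₀ (fun _ V => ⟨next V, hnext V⟩) n
  obtain ⟨H, hH, j, q, hj, hq, hfac⟩ := hL.exists_homotopyColimit (fun n => (W n).1.left)
    (fun n => (W n).2) (fun n => (t (W n)).left) (fun n => (W n).1.hom)
    (fun n => Over.w (t (W n)))
  refine ⟨H, q, hH, fun k => ⟨fun f f' h => ?_, fun f => ?_⟩⟩
  · rw [← sub_eq_zero]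
    obtain ⟨n, g, hg⟩ := hfac (hc k) (f - f')
    have h₀ : (f - f') ≫ q = 0 := by
      rw [Preadditive.sub_comp, sub_eq_zero]
      exact h
    rw [hg, Category.assoc, hq] at h₀
    rw [hg, ← hj, ← Category.assoc, ht (W n) k g h₀, zero_comp]
  · refine ⟨Sigma.ι (fun j : J => s j.1) ⟨k, f⟩ ≫ j 0, ?_⟩
    dsimp only
    rw [Category.assoc, hq]
    exact Sigma.ι_desc (f := fun j : J => s j.1) (fun j : J => j.2) ⟨k, f⟩

/-- For a small set `S` of compact objects, every object `X` sits in a distinguished triangle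
`X' ⟶ X ⟶ Y ⟶ X'⟦1⟧` with `X'` in the localising closure of `S` and `Y` right orthogonal to all
shifts of objects of `S`. -/
lemma exists_localisation_triangle (S : Set C) [Small.{v} S] (hS : ∀ x ∈ S, IsCompactObject x)
    (X : C) :
    ∃ (X' Y : C) (q : X' ⟶ X) (r : X ⟶ Y) (δ : Y ⟶ X'⟦(1 : ℤ)⟧),
      Triangle.mk q r δ ∈ distTriang C ∧ X' ∈ localisingClosure S ∧
      ∀ x ∈ S, ∀ (n : ℤ) (f : x⟦n⟧ ⟶ Y), f = 0 := by
  have hL := isLocalisingSubcategory_localisingClosure S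
  let s : Shrink.{v} S × ULift.{v} ℤ → C := fun k => ((equivShrink S).symm k.1).1⟦k.2.down⟧
  obtain ⟨X', q, hX', hq⟩ := hL.exists_approximation s
    (fun k => hL.shift_mem _ (subset_localisingClosure S (Subtype.coe_prop _)))
    (fun k => (hS _ (Subtype.coe_prop _)).shift _) X
  have hq' : ∀ x ∈ S, ∀ n : ℤ, Function.Bijective (fun f : x⟦n⟧ ⟶ X' => f ≫ q) := by
    intro x hx n
    obtain ⟨y, hy⟩ := (equivShrink S).symm.surjective ⟨x, hx⟩
    have h := hq (y, ⟨n⟩)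
    dsimp only [s] at h
    rwa [hy] at h
  obtain ⟨Y, r, δ, hT⟩ := distinguished_cocone_triangle q
  refine ⟨X', Y, q, r, δ, hT, hX', fun x hx n f => ?_⟩
  have hδ : f ≫ δ = 0 := by
    have h₀ : (f ≫ δ) ≫ q⟦(1 : ℤ)⟧' = 0 := by
      have : δ ≫ q⟦(1 : ℤ)⟧' = 0 := comp_distTriang_mor_zero₃₁ _ hT
      rw [Category.assoc, this, comp_zero]
    let e : (x⟦n - 1⟧)⟦(1 : ℤ)⟧ ≅ x⟦n⟧ :=
      ((shiftFunctorAdd' C (n - 1) 1 n (by lia)).app x).symm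
    obtain ⟨g, hg⟩ := (shiftFunctor C (1 : ℤ)).map_surjective (e.hom ≫ f ≫ δ)
    have hg₀ : g ≫ q = 0 := by
      apply (shiftFunctor C (1 : ℤ)).map_injective
      rw [Functor.map_comp, hg, Category.assoc, h₀, comp_zero, Functor.map_zero]
    have : g = 0 := (hq' x hx (n - 1)).1 (by simpa using hg₀)
    rw [← cancel_epi e.hom, ← hg, this, Functor.map_zero, comp_zero]
  obtain ⟨u, hu⟩ : ∃ u : x⟦n⟧ ⟶ X, f = u ≫ r := Triangle.coyoneda_exact₃ _ hT f hδ
  obtain ⟨w, rfl⟩ := (hq' x hx n).2 u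
  have h₀ : q ≫ r = 0 := comp_distTriang_mor_zero₁₂ _ hT
  dsimp only at hu
  rw [hu, Category.assoc, h₀, comp_zero]

end Localising

/-- if a family of coproduct-preserving exact functors `Fᵢ : T ⥤ Tᵢ` with
exact left adjoints `Lᵢ` into compactly generated triangulated categories jointly detects
zero objects, then the objects `Lᵢ(c)` for `c` in the chosen compact generators are
compact and compactly generate `T`. -/
theorem statement10 {T : Type u} [Category.{v} T] [Preadditive T] [HasCoproducts.{v} T]
    [HasZeroObject T] [HasShift T ℤ] [∀ n : ℤ, (shiftFunctor T n).Additive]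
    [Pretriangulated T]
    {I : Type v} (Ti : I → Type u₂) [∀ i, Category.{v} (Ti i)]
    [∀ i, Preadditive (Ti i)] [∀ i, HasCoproducts.{v} (Ti i)]
    [∀ i, HasZeroObject (Ti i)] [∀ i, HasShift (Ti i) ℤ]
    [∀ i (n : ℤ), (shiftFunctor (Ti i) n).Additive] [∀ i, Pretriangulated (Ti i)]
    -- each `Ti` is compactly generated by a set `Gs i` of compact objects
    (Gs : ∀ i, Set (Ti i)) (hGs : ∀ i, IsCompactlyGeneratedBy (Ti i) (Gs i))
    -- exact coproduct-preserving functors `F i : T ⥤ Ti i`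
    (F : ∀ i, T ⥤ Ti i) [∀ i, (F i).CommShift ℤ] [∀ i, (F i).IsTriangulated]
    [∀ i (ι : Type v), PreservesColimitsOfShape (Discrete ι) (F i)]
    -- with exact left adjoints `L i`
    (Lf : ∀ i, Ti i ⥤ T) [∀ i, (Lf i).CommShift ℤ] [∀ i, (Lf i).IsTriangulated]
    (adj : ∀ i, Lf i ⊣ F i)
    -- the detection property
    (detect : ∀ X : T, IsZero X ↔ ∀ i, IsZero ((F i).obj X)) :
    (∀ i, ∀ c ∈ Gs i, IsCompactObject ((Lf i).obj c)) ∧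
    IsCompactlyGeneratedBy T {X : T | ∃ i, ∃ c ∈ Gs i, (Lf i).obj c = X} := by
  have hcompact : ∀ i, ∀ c ∈ Gs i, IsCompactObject ((Lf i).obj c) :=
    fun i c hc => ((hGs i).1 c hc).of_adjunction (adj i)
  refine ⟨hcompact, ?_, fun L hL hS X => ?_⟩
  · rintro _ ⟨i, c, hc, rfl⟩
    exact hcompact i c hc
  choose g hgsub hgsmall hg using fun i (Z : Ti i) =>
    exists_small_of_mem_localisingClosure (S := Gs i) (X := Z)
      fun L hL hS => (hGs i).2 L hL hS Z
  -- a small family of sets of generators, containing enough of them to build `F i X`,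
  -- closed under adding the generators needed to build `F i (Lf j c)`
  obtain ⟨A, hAzero, hAsucc⟩ : ∃ A : ℕ → ∀ i, Set (Ti i),
      (∀ i, A 0 i = g i ((F i).obj X)) ∧
      ∀ n i, A (n + 1) i = ⋃ j, ⋃ c : A n j, g i ((F i).obj ((Lf j).obj c.1)) :=
    ⟨fun n => Nat.rec (fun i => g i ((F i).obj X))
      (fun _ B i => ⋃ j, ⋃ c : B j, g i ((F i).obj ((Lf j).obj c.1))) n,
      fun _ => rfl, fun _ _ => rfl⟩
  have hAsmall : ∀ n i, Small.{v} ↥(A n i) := by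
    intro n
    induction n with
    | zero => exact fun i => hAzero i ▸ hgsmall i _
    | succ n ih => exact fun i => hAsucc n i ▸ small_iUnion _
  have hAsub : ∀ n i, A n i ⊆ Gs i := by
    intro n i
    cases n with
    | zero => exact hAzero i ▸ hgsub i _
    | succ n => exact hAsucc n i ▸ Set.iUnion_subset fun j => Set.iUnion_subset fun c => hgsub i _
  let S : Set T := ⋃ i, (Lf i).obj '' ⋃ n, A n i
  have hSgen : S ⊆ {X : T | ∃ i, ∃ c ∈ Gs i, (Lf i).obj c = X} := by
    refine Set.iUnion_subset fun i => ?_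
    rintro _ ⟨c, hc, rfl⟩
    obtain ⟨n, hn⟩ := Set.mem_iUnion.1 hc
    exact ⟨i, c, hAsub n i hn, rfl⟩
  have hScompact : ∀ x ∈ S, IsCompactObject x := by
    intro x hx
    obtain ⟨i, c, hc, rfl⟩ := hSgen hx
    exact hcompact i c hc
  have hSsmall : Small.{v} ↥S := by
    have (i : I) : Small.{v} ↥(⋃ n, A n i) := small_iUnion _
    exact small_iUnion _
  obtain ⟨X', Y, q, r, δ, hT, hX', hY⟩ := exists_localisation_triangle S hScompact X
  have hYzero : IsZero Y := by
    rw [detect]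
    intro i
    have hloc := isLocalisingSubcategory_localisingClosure (⋃ n, A n i)
    have hFX : (F i).obj X ∈ localisingClosure (⋃ n, A n i) :=
      localisingClosure_mono
        ((hAzero i).symm.subset.trans (Set.subset_iUnion (fun n => A n i) 0)) (hg i _)
    have hFX' : (F i).obj X' ∈ localisingClosure (⋃ n, A n i) := by
      refine localisingClosure_subset (hloc.preimage (F i)) (Set.iUnion_subset fun j => ?_) hX'
      rintro _ ⟨c, hc, rfl⟩
      obtain ⟨n, hn⟩ := Set.mem_iUnion.1 hc
      refine localisingClosure_mono ?_ (hg i _)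
      exact (Set.subset_iUnion_of_subset j
          (Set.subset_iUnion (fun c : A n j => g i ((F i).obj ((Lf j).obj c.1))) ⟨c, hn⟩)).trans
        ((hAsucc n i).symm.subset.trans <| Set.subset_iUnion (fun n => A n i) (n + 1))
    refine isZero_of_mem_localisingClosure
      (hloc.obj₃_mem _ ((F i).map_distinguished _ hT) hFX' hFX) fun c hc n f => ?_
    apply ((adj i).homEquiv _ _).symm.injective
    rw [← cancel_epi (((Lf i).commShiftIso n).app c).inv]
    trans 0
    · exact hY _ (Set.mem_iUnion.2 ⟨i, c, hc, rfl⟩) n _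
    · simp [Adjunction.homEquiv_counit]
  have : IsIso q := (Triangle.isZero₃_iff_isIso₁ _ hT).1 hYzero
  exact hL.mem_of_iso (asIso q) (localisingClosure_subset hL (hSgen.trans hS) hX')
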